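/- Let α > 0, I = [a,T], fix points a = t_0 < t_1 < ⋯ < t_m < t_{m+1} = T, and let c ≥ 0, λ ≥ 0 and β_1, …, β_m > 0 be constants. Let u : I → ℝ be integrable and nonnegative. If u(t) ≤ c + λ ∫_a^t (t − s)^{α−1} u(s) ds + ∑_{a < t_i < t} β_i u(t_i) for all t ∈ I, then for every k ∈ {0,1,…,m} and every t ∈ (t_k, t_{k+1}], u(t) ≤ c · [ ∏_{i=1}^{k} (1 + β_i E_α(λ Γ(α)(t_i − a)^α)) ] · E_α(λ Γ(α)(t − a)^α). -/

import Mathlib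

open MeasureTheory Finset

/-- The Mittag-Leffler function `E_α(z) = ∑_{k=0}^∞ z^k / Γ(αk + 1)`. -/
noncomputable def mittagLeffler (α z : ℝ) : ℝ :=
  ∑' k : ℕ, z ^ k / Real.Gamma (α * k + 1)

/-- The Abel kernel `l * x ^ (α - 1)`, extended by zero to `x ≤ 0`. -/
noncomputable def abelKernel (α l x : ℝ) : ENNReal :=
  (Set.Ioi (0 : ℝ)).indicator (fun x => ENNReal.ofReal (l * x ^ (α - 1))) x

theorem measurable_abelKernel (α l : ℝ) : Measurable (abelKernel α l) :=
  Measurable.indicator (by fun_prop) measurableSet_Ioi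

theorem abelKernel_of_pos {α l x : ℝ} (hx : 0 < x) :
    abelKernel α l x = ENNReal.ofReal (l * x ^ (α - 1)) :=
  Set.indicator_of_mem (Set.mem_Ioi.2 hx) _

theorem abelKernel_of_nonpos {α l x : ℝ} (hx : x ≤ 0) : abelKernel α l x = 0 :=
  Set.indicator_of_notMem (Set.notMem_Ioi.2 hx) _

theorem lintegral_abelKernel_mul {α l a b t : ℝ} (ht : t ≤ b) (f : ℝ → ENNReal) :
    ∫⁻ s in Set.Ioc a b, abelKernel α l (t - s) * f s =
      ∫⁻ s in Set.Ioo a t, ENNReal.ofReal (l * (t - s) ^ (α - 1)) * f s := by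
  rw [← lintegral_indicator measurableSet_Ioc, ← lintegral_indicator measurableSet_Ioo]
  refine lintegral_congr fun s => ?_
  by_cases hs : s ∈ Set.Ioo a t
  · rw [Set.indicator_of_mem hs, Set.indicator_of_mem (show s ∈ Set.Ioc a b from ⟨hs.1, hs.2.le.trans ht⟩),
      abelKernel_of_pos (sub_pos.2 hs.2)]
  · rw [Set.indicator_of_notMem hs]
    by_cases has : a < s
    · have hts : t ≤ s := not_lt.1 fun h => hs ⟨has, h⟩
      rw [Set.indicator_apply_eq_zero]
      intro _
      rw [abelKernel_of_nonpos (sub_nonpos.2 hts), zero_mul]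
    · exact Set.indicator_of_notMem (fun h => has h.1) _

theorem lintegral_sub_rpow_mul_sub_rpow {p q a t : ℝ} (hp : 0 < p) (hq : 0 ≤ q) (hat : a < t) :
    ∫⁻ s in Set.Ioo a t, ENNReal.ofReal ((t - s) ^ (p - 1) * (s - a) ^ q) =
      ENNReal.ofReal
        (Real.Gamma p * Real.Gamma (q + 1) / Real.Gamma (q + p + 1) * (t - a) ^ (q + p)) := by
  have hd : 0 < t - a := sub_pos.2 hat
  have himage : (fun x => (t - a) * x + a) '' Set.Ioo (0 : ℝ) 1 = Set.Ioo a t := by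
    rw [Set.image_affine_Ioo hd]
    congr 1 <;> ring
  have hbeta : 0 < ProbabilityTheory.beta (q + 1) p :=
    ProbabilityTheory.beta_pos (by linarith) hp
  rw [← himage, lintegral_image_eq_lintegral_abs_deriv_mul (f' := fun _ => t - a)
    measurableSet_Ioo
    (fun x _ => by
      simpa using (((hasDerivAt_id x).const_mul (t - a)).add_const a).hasDerivWithinAt)
    (fun x _ y _ h => by
      have h' : (t - a) * x = (t - a) * y := by simpa using h
      exact mul_left_cancel₀ hd.ne' h')]
  have hconst : ∀ x ∈ Set.Ioo (0 : ℝ) 1,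
      ENNReal.ofReal |t - a| * ENNReal.ofReal
        ((t - ((t - a) * x + a)) ^ (p - 1) * ((t - a) * x + a - a) ^ q) =
      ENNReal.ofReal (ProbabilityTheory.beta (q + 1) p * (t - a) ^ (q + p)) *
        ENNReal.ofReal (1 / ProbabilityTheory.beta (q + 1) p * x ^ (q + 1 - 1) *
          (1 - x) ^ (p - 1)) := by
    intro x hx
    have hx1 : 0 < 1 - x := sub_pos.2 hx.2
    rw [← ENNReal.ofReal_mul (abs_nonneg _), ← ENNReal.ofReal_mul (by positivity)]
    congr 1
    rw [abs_of_pos hd, show t - ((t - a) * x + a) = (t - a) * (1 - x) by ring,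
      show (t - a) * x + a - a = (t - a) * x by ring,
      Real.mul_rpow hd.le hx1.le, Real.mul_rpow hd.le hx.1.le, add_sub_cancel_right]
    have hsplit : (t - a) ^ (q + p) = (t - a) * (t - a) ^ (p - 1) * (t - a) ^ q := by
      rw [← Real.rpow_one_add' hd.le (by linarith), ← Real.rpow_add hd]
      congr 1; ring
    rw [hsplit]
    field_simp
  rw [setLIntegral_congr_fun measurableSet_Ioo hconst,
    lintegral_const_mul _ (by fun_prop), ← ProbabilityTheory.lintegral_betaPDF,
    ProbabilityTheory.lintegral_betaPDF_eq_one (by linarith) hp, mul_one]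
  unfold ProbabilityTheory.beta
  congr 2
  rw [show q + 1 + p = q + p + 1 by ring]
  ring

theorem rpow_mul_exp_neg_le_Gamma {x R : ℝ} (hx : 0 ≤ x) (hR : 0 ≤ R) :
    R ^ x * Real.exp (-R) ≤ Real.Gamma (x + 1) := by
  have hint : IntegrableOn (fun y : ℝ => Real.exp (-y) * y ^ x) (Set.Ioi 0) := by
    simpa using Real.GammaIntegral_convergent (s := x + 1) (by linarith)
  rw [Real.Gamma_eq_integral (by linarith), add_sub_cancel_right, ← integral_exp_neg_Ioi R,
    ← integral_const_mul]
  calc ∫ y in Set.Ioi R, R ^ x * Real.exp (-y)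
      ≤ ∫ y in Set.Ioi R, Real.exp (-y) * y ^ x := by
        refine setIntegral_mono_on ((integrableOn_exp_neg_Ioi R).const_mul _)
          (hint.mono_set (Set.Ioi_subset_Ioi hR)) measurableSet_Ioi fun y hy => ?_
        rw [mul_comm]
        gcongr
        exact (Set.mem_Ioi.1 hy).le
    _ ≤ ∫ y in Set.Ioi 0, Real.exp (-y) * y ^ x := by
        refine setIntegral_mono_set hint ?_ (Set.Ioi_subset_Ioi hR).eventuallyLE
        filter_upwards [ae_restrict_mem measurableSet_Ioi] with y hy
        have : (0 : ℝ) < y := hy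
        simp only [Pi.zero_apply]
        positivity

theorem summable_mittagLeffler {α z : ℝ} (hα : 0 < α) (hz : 0 ≤ z) :
    Summable fun k : ℕ => z ^ k / Real.Gamma (α * k + 1) := by
  set R : ℝ := (2 * z + 1) ^ α⁻¹ with hRdef
  have hR : 0 < R := by positivity
  have hRα : R ^ α = 2 * z + 1 := Real.rpow_inv_rpow (by positivity) hα.ne'
  have hlt : z / (2 * z + 1) < 1 := by rw [div_lt_one (by positivity)]; linarith
  refine Summable.of_nonneg_of_le (fun k => ?_) (fun k => ?_)
    ((summable_geometric_of_lt_one (by positivity) hlt).mul_left (Real.exp R))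
  · have := Real.Gamma_pos_of_pos (show 0 < α * k + 1 by positivity)
    positivity
  · have hΓ := rpow_mul_exp_neg_le_Gamma (show 0 ≤ α * k by positivity) hR.le
    rw [Real.rpow_mul_natCast hR.le, hRα] at hΓ
    calc z ^ k / Real.Gamma (α * k + 1)
        ≤ z ^ k / ((2 * z + 1) ^ k * Real.exp (-R)) := by gcongr
      _ = Real.exp R * (z / (2 * z + 1)) ^ k := by
        rw [Real.exp_neg, div_pow]; field_simp

theorem mittagLeffler_nonneg {α z : ℝ} (hα : 0 < α) (hz : 0 ≤ z) : 0 ≤ mittagLeffler α z :=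
  tsum_nonneg fun k => by
    have := Real.Gamma_pos_of_pos (show 0 < α * k + 1 by positivity)
    positivity

theorem lintegral_abelKernel_mul_exp {α l M : ℝ} (hα : 0 < α) (hl : 0 ≤ l) (hM : 0 < M) :
    ∫⁻ x, abelKernel α l x * ENNReal.ofReal (Real.exp (-(M * x))) =
      ENNReal.ofReal (l * Real.Gamma α / M ^ α) := by
  have hmul : (fun x => abelKernel α l x * ENNReal.ofReal (Real.exp (-(M * x)))) =
      (Set.Ioi (0 : ℝ)).indicator
        fun x => ENNReal.ofReal (l * (x ^ (α - 1) * Real.exp (-(M * x)))) := by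
    ext x
    rcases lt_or_ge 0 x with hx | hx
    · rw [abelKernel_of_pos hx, Set.indicator_of_mem (Set.mem_Ioi.2 hx),
        ← ENNReal.ofReal_mul (by positivity), mul_assoc]
    · rw [abelKernel_of_nonpos hx, Set.indicator_of_notMem (Set.notMem_Ioi.2 hx), zero_mul]
  have hval := Real.integral_rpow_mul_exp_neg_mul_Ioi hα hM
  have hint : IntegrableOn (fun x : ℝ => x ^ (α - 1) * Real.exp (-(M * x))) (Set.Ioi 0) := by
    refine not_imp_comm.1 integral_undef ?_
    rw [hval]
    have := Real.Gamma_pos_of_pos hα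
    positivity
  rw [hmul, lintegral_indicator measurableSet_Ioi, ← ofReal_integral_eq_lintegral_ofReal
    (hint.const_mul l), integral_const_mul, hval]
  · congr 1
    rw [Real.div_rpow zero_le_one hM.le, Real.one_rpow]; ring
  · filter_upwards [ae_restrict_mem measurableSet_Ioi] with x hx
    have : (0 : ℝ) < x := hx
    simp only [Pi.zero_apply]
    positivity

theorem eq_zero_of_le_lintegral_abelKernel_mul {α l a b : ℝ} (hα : 0 < α) (hl : 0 ≤ l)
    {w : ℝ → ENNReal} (hw : AEMeasurable w (volume.restrict (Set.Ioc a b)))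
    (hw_fin : ∫⁻ s in Set.Ioc a b, w s ≠ ⊤)
    (hle : ∀ t ∈ Set.Ioc a b, w t ≤ ∫⁻ s in Set.Ioc a b, abelKernel α l (t - s) * w s) :
    ∀ t ∈ Set.Ioc a b, w t = 0 := by
  have hΓ := Real.Gamma_pos_of_pos hα
  set M : ℝ := (l * Real.Gamma α + 1) ^ α⁻¹ with hMdef
  have hM : 0 < M := by positivity
  have hMα : M ^ α = l * Real.Gamma α + 1 := Real.rpow_inv_rpow (by positivity) hα.ne'
  set q : ENNReal := ENNReal.ofReal (l * Real.Gamma α / M ^ α) with hq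
  have hq1 : q < 1 := by
    rw [hq, ENNReal.ofReal_lt_one, hMα, div_lt_one (by positivity)]
    linarith
  set φ : ℝ → ENNReal := fun x => ENNReal.ofReal (Real.exp (-(M * x))) with hφ
  have hφm : Measurable φ := by fun_prop
  have hφ_add : ∀ x y, φ (x + y) = φ x * φ y := fun x y => by
    simp only [hφ]
    rw [← ENNReal.ofReal_mul (Real.exp_pos _).le, ← Real.exp_add]
    congr 2; ring
  set μ : Measure ℝ := volume.restrict (Set.Ioc a b) with hμ
  set W : ENNReal := ∫⁻ t, φ t * w t ∂μ with hW
  have hWfin : W ≠ ⊤ := by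
    refine ne_top_of_le_ne_top (ENNReal.mul_ne_top (ENNReal.ofReal_ne_top (r := Real.exp (-(M * a))))
      hw_fin) ?_
    rw [← lintegral_const_mul' _ _ ENNReal.ofReal_ne_top]
    refine setLIntegral_mono' measurableSet_Ioc fun t ht => ?_
    simp only [hφ]
    gcongr
    exact ht.1.le
  have hKm : Measurable fun p : ℝ × ℝ => abelKernel α l (p.1 - p.2) :=
    (measurable_abelKernel α l).comp (measurable_fst.sub measurable_snd)
  have hWle : W ≤ q * W := by
    calc W ≤ ∫⁻ t, ∫⁻ s, φ t * (abelKernel α l (t - s) * w s) ∂μ ∂μ := by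
          refine setLIntegral_mono' measurableSet_Ioc fun t ht => ?_
          rw [lintegral_const_mul' _ _ ENNReal.ofReal_ne_top]
          exact mul_le_mul_right (hle t ht) _
      _ = ∫⁻ s, ∫⁻ t, φ t * (abelKernel α l (t - s) * w s) ∂μ ∂μ := by
          apply lintegral_lintegral_swap
          exact (hφm.comp measurable_fst).aemeasurable.mul
            (hKm.aemeasurable.mul (hw.comp_snd))
      _ ≤ ∫⁻ s, q * (φ s * w s) ∂μ := by
          refine lintegral_mono fun s => ?_
          calc ∫⁻ t, φ t * (abelKernel α l (t - s) * w s) ∂μ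
              ≤ ∫⁻ t, φ t * (abelKernel α l (t - s) * w s) := setLIntegral_le_lintegral _ _
            _ = ∫⁻ t, abelKernel α l (t - s) * φ (t - s) * (φ s * w s) := by
                refine lintegral_congr fun t => ?_
                rw [show φ t = φ (t - s) * φ s by rw [← hφ_add, sub_add_cancel]]
                ring
            _ = (∫⁻ t, abelKernel α l (t - s) * φ (t - s)) * (φ s * w s) := by
                refine lintegral_mul_const _ ?_
                exact ((measurable_abelKernel α l).mul hφm).comp (measurable_id.sub_const s)
            _ = q * (φ s * w s) := by
                rw [lintegral_sub_right_eq_self (fun x => abelKernel α l x * φ x) s,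
                  lintegral_abelKernel_mul_exp hα hl hM]
      _ = q * W := lintegral_const_mul' _ _ ENNReal.ofReal_ne_top
  have hW0 : W = 0 := by
    by_contra hne
    have := ENNReal.mul_lt_mul_left hne hWfin hq1
    rw [one_mul] at this
    exact absurd hWle (not_le.2 this)
  have hw0 : w =ᵐ[μ] 0 := by
    filter_upwards [(lintegral_eq_zero_iff' (hφm.aemeasurable.mul hw)).1 hW0] with t ht
    refine (mul_eq_zero.1 ht).resolve_left ?_
    simp [hφ, Real.exp_pos]
  intro t ht
  refine le_antisymm ((hle t ht).trans_eq ?_) zero_le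
  rw [lintegral_congr_ae (g := 0) (hw0.mono fun s hs => by simp [hs])]
  simp

theorem add_lintegral_abelKernel_mul_mittagLeffler {α l a b c t : ℝ} (hα : 0 < α) (hl : 0 ≤ l)
    (hc : 0 ≤ c) (ht : t ∈ Set.Ioc a b) :
    ENNReal.ofReal c + ∫⁻ s in Set.Ioc a b, abelKernel α l (t - s) *
        ENNReal.ofReal (c * mittagLeffler α (l * Real.Gamma α * (s - a) ^ α)) =
      ENNReal.ofReal (c * mittagLeffler α (l * Real.Gamma α * (t - a) ^ α)) := by
  have hΓ := Real.Gamma_pos_of_pos hα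
  have hΓk (k : ℕ) : 0 < Real.Gamma (α * k + 1) := Real.Gamma_pos_of_pos (by positivity)
  set A : ℕ → ℝ := fun k => c * (l * Real.Gamma α) ^ k / Real.Gamma (α * k + 1) with hA
  have hA0 (k : ℕ) : 0 ≤ A k := by
    have := hΓk k
    simp only [hA]
    positivity
  have hseries : ∀ s, a < s →
      ENNReal.ofReal (c * mittagLeffler α (l * Real.Gamma α * (s - a) ^ α)) =
        ∑' k : ℕ, ENNReal.ofReal (A k * (s - a) ^ (α * k)) := by
    intro s hs
    have hs0 : 0 < s - a := sub_pos.2 hs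
    rw [mittagLeffler, ← tsum_mul_left, ENNReal.ofReal_tsum_of_nonneg]
    · refine tsum_congr fun k => ?_
      rw [Real.rpow_mul_natCast hs0.le, mul_pow]
      congr 1
      simp only [hA]
      ring
    · intro k
      have := hΓk k
      positivity
    · exact (summable_mittagLeffler hα (by positivity)).mul_left c
  have hta : 0 < t - a := sub_pos.2 ht.1
  have hterm (k : ℕ) : ∫⁻ s in Set.Ioo a t, ENNReal.ofReal (l * (t - s) ^ (α - 1)) *
      ENNReal.ofReal (A k * (s - a) ^ (α * k)) =
        ENNReal.ofReal (A (k + 1) * (t - a) ^ (α * (k + 1 : ℕ))) := by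
    have hsplit : ∀ s ∈ Set.Ioo a t, ENNReal.ofReal (l * (t - s) ^ (α - 1)) *
        ENNReal.ofReal (A k * (s - a) ^ (α * k)) =
        ENNReal.ofReal (l * A k) * ENNReal.ofReal ((t - s) ^ (α - 1) * (s - a) ^ (α * k)) := by
      intro s hs
      have h1 : 0 < t - s := sub_pos.2 hs.2
      have := hA0 k
      rw [← ENNReal.ofReal_mul (by positivity), ← ENNReal.ofReal_mul (by positivity)]
      congr 1; ring
    rw [setLIntegral_congr_fun measurableSet_Ioo hsplit,
      lintegral_const_mul' _ _ ENNReal.ofReal_ne_top,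
      lintegral_sub_rpow_mul_sub_rpow hα (by positivity) ht.1,
      ← ENNReal.ofReal_mul (mul_nonneg hl (hA0 k))]
    have hexp : α * (k + 1 : ℕ) = α * k + α := by push_cast; ring
    have := (hΓk k).ne'
    simp only [hA]
    rw [hexp, pow_succ]
    congr 1
    field_simp
  have hmeas (k : ℕ) : AEMeasurable (fun s => ENNReal.ofReal (l * (t - s) ^ (α - 1)) *
      ENNReal.ofReal (A k * (s - a) ^ (α * k))) (volume.restrict (Set.Ioo a t)) := by
    fun_prop
  rw [lintegral_abelKernel_mul ht.2, hseries t ht.1, tsum_eq_zero_add' ENNReal.summable,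
    setLIntegral_congr_fun measurableSet_Ioo
      (fun s hs => by rw [hseries s hs.1, ← ENNReal.tsum_mul_left]),
    lintegral_tsum hmeas]
  simp only [hterm]
  simp [hA]

theorem fractional_gronwall {α a b c l : ℝ} (hα : 0 < α) (hc : 0 ≤ c) (hl : 0 ≤ l) {u : ℝ → ℝ}
    (hu_int : IntegrableOn u (Set.Ioc a b)) (hu_nonneg : ∀ t ∈ Set.Ioc a b, 0 ≤ u t)
    (hineq : ∀ t ∈ Set.Ioc a b, u t ≤ c + l * ∫ s in a..t, (t - s) ^ (α - 1) * u s) :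
    ∀ t ∈ Set.Ioc a b, u t ≤ c * mittagLeffler α (l * Real.Gamma α * (t - a) ^ α) := by
  set v : ℝ → ENNReal := fun t =>
    ENNReal.ofReal (c * mittagLeffler α (l * Real.Gamma α * (t - a) ^ α)) with hv
  set U : ℝ → ENNReal := fun t => ENNReal.ofReal (u t) with hU
  have hUm : AEMeasurable U (volume.restrict (Set.Ioc a b)) := hu_int.aemeasurable.ennreal_ofReal
  have hvm : Measurable v := by
    have : Measurable (mittagLeffler α) := by
      unfold mittagLeffler
      fun_prop
    fun_prop
  have hKm (t : ℝ) : Measurable fun s => abelKernel α l (t - s) :=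
    (measurable_abelKernel α l).comp (measurable_const.sub measurable_id)
  have hUle : ∀ t ∈ Set.Ioc a b,
      U t ≤ ENNReal.ofReal c + ∫⁻ s in Set.Ioc a b, abelKernel α l (t - s) * U s := by
    intro t ht
    refine (ENNReal.ofReal_le_ofReal (hineq t ht)).trans (ENNReal.ofReal_add_le.trans ?_)
    gcongr
    rw [lintegral_abelKernel_mul ht.2, intervalIntegral.integral_of_le ht.1.le,
      integral_Ioc_eq_integral_Ioo, ← integral_const_mul, integral_eq_lintegral_of_nonneg_ae]
    · refine ENNReal.ofReal_toReal_le.trans_eq ?_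
      refine setLIntegral_congr_fun measurableSet_Ioo fun s hs => ?_
      have : 0 < t - s := sub_pos.2 hs.2
      simp only [hU]
      rw [← ENNReal.ofReal_mul (by positivity), mul_assoc]
    · filter_upwards [ae_restrict_mem measurableSet_Ioo] with s hs
      have h1 : 0 < t - s := sub_pos.2 hs.2
      have h2 := hu_nonneg s ⟨hs.1, hs.2.le.trans ht.2⟩
      simp only [Pi.zero_apply]
      positivity
    · have hum := (hu_int.mono_set (show Set.Ioo a t ⊆ Set.Ioc a b from
        fun s hs => ⟨hs.1, hs.2.le.trans ht.2⟩)).aestronglyMeasurable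
      have hk : Measurable fun s : ℝ => (t - s) ^ (α - 1) := by fun_prop
      exact (hk.aestronglyMeasurable.mul hum).const_mul l
  have hfin : ∫⁻ s in Set.Ioc a b, U s ≠ ⊤ := by
    rw [← ofReal_integral_eq_lintegral_ofReal hu_int (by
      filter_upwards [ae_restrict_mem measurableSet_Ioc] with s hs using hu_nonneg s hs)]
    exact ENNReal.ofReal_ne_top
  have hzero := eq_zero_of_le_lintegral_abelKernel_mul (w := fun t => U t - v t) hα hl
    (hUm.sub hvm.aemeasurable)
    (ne_top_of_le_ne_top hfin (lintegral_mono fun s => tsub_le_self)) (by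
      intro t ht
      rw [tsub_le_iff_right]
      calc U t ≤ ENNReal.ofReal c + ∫⁻ s in Set.Ioc a b, abelKernel α l (t - s) * U s := hUle t ht
        _ ≤ ENNReal.ofReal c + ∫⁻ s in Set.Ioc a b, (abelKernel α l (t - s) * v s +
              abelKernel α l (t - s) * (U s - v s)) := by
            gcongr with s
            rw [← mul_add]
            gcongr
            exact le_add_tsub
        _ = (ENNReal.ofReal c + ∫⁻ s in Set.Ioc a b, abelKernel α l (t - s) * v s) +
              ∫⁻ s in Set.Ioc a b, abelKernel α l (t - s) * (U s - v s) := by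
            rw [lintegral_add_left (by exact (hKm t).mul hvm), add_assoc]
        _ = _ := by
            rw [add_lintegral_abelKernel_mul_mittagLeffler hα hl hc ht, add_comm])
  intro t ht
  have hta : 0 < t - a := sub_pos.2 ht.1
  have hΓ := Real.Gamma_pos_of_pos hα
  exact (ENNReal.ofReal_le_ofReal_iff (mul_nonneg hc
    (mittagLeffler_nonneg hα (by positivity)))).1 (tsub_eq_zero_iff_le.1 (hzero t ht))

/-- Impulsive fractional Gronwall inequality with constants `c` and `λ`
    (Theorem 2.6 of Choi–Koo, particular case of the paper's Theorem 2). -/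
theorem impulsive_fractional_gronwall_const_c_lambda
    (α a T : ℝ) (hα : 0 < α) (haT : a < T)
    (m : ℕ) (tp : ℕ → ℝ)
    (htp0 : tp 0 = a) (htpT : tp (m + 1) = T)
    (htp_mono : ∀ i ≤ m, tp i < tp (i + 1))
    (c lam : ℝ) (hc : 0 ≤ c) (hlam : 0 ≤ lam)
    (β : ℕ → ℝ) (hβ : ∀ i, 1 ≤ i → i ≤ m → 0 < β i)
    (u : ℝ → ℝ)
    (hu_int : IntegrableOn u (Set.Icc a T))
    (hu_nonneg : ∀ t ∈ Set.Icc a T, 0 ≤ u t)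
    (hineq : ∀ t ∈ Set.Icc a T,
      u t ≤ c + lam * (∫ s in a..t, (t - s) ^ (α - 1) * u s) +
        ∑ i ∈ (Finset.Icc 1 m).filter (fun i => tp i < t), β i * u (tp i)) :
    ∀ k ≤ m, ∀ t ∈ Set.Ioc (tp k) (tp (k + 1)),
      u t ≤ c *
        (∏ i ∈ Finset.Icc 1 k,
          (1 + β i * mittagLeffler α (lam * Real.Gamma α * (tp i - a) ^ α))) *
        mittagLeffler α (lam * Real.Gamma α * (t - a) ^ α) := by
  have hmono : ∀ i j, i ≤ j → j ≤ m + 1 → tp i ≤ tp j := by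
    intro i j hij
    induction j, hij using Nat.le_induction with
    | base => exact fun _ => le_rfl
    | succ j _ ih => exact fun hj => (ih (by omega)).trans (htp_mono j (by omega)).le
  have ha_lt : ∀ i, 1 ≤ i → i ≤ m + 1 → a < tp i := fun i h1 h2 =>
    htp0 ▸ (htp_mono 0 (Nat.zero_le m)).trans_le (hmono 1 i h1 h2)
  have hΓ := Real.Gamma_pos_of_pos hα
  set E : ℝ → ℝ := fun t => mittagLeffler α (lam * Real.Gamma α * (t - a) ^ α) with hE
  have hE0 : ∀ t, a ≤ t → 0 ≤ E t := fun t ht => by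
    have := sub_nonneg.2 ht
    exact mittagLeffler_nonneg hα (by positivity)
  set C : ℕ → ℝ := fun k => c * ∏ i ∈ Finset.Icc 1 k, (1 + β i * E (tp i)) with hC
  have hC0 : ∀ k ≤ m, 0 ≤ C k := fun k hk => by
    refine mul_nonneg hc (Finset.prod_nonneg fun i hi => ?_)
    obtain ⟨h1, h2⟩ := Finset.mem_Icc.1 hi
    have := hE0 (tp i) (ha_lt i h1 (by omega)).le
    have := hβ i h1 (h2.trans hk)
    positivity
  have hC_sum : ∀ k, c + ∑ i ∈ Finset.Icc 1 k, β i * (C (i - 1) * E (tp i)) = C k := by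
    intro k
    induction k with
    | zero => simp [hC]
    | succ k ih =>
      rw [Finset.sum_Icc_succ_top (by omega), ← add_assoc, ih, Nat.add_sub_cancel]
      simp only [hC]
      rw [Finset.prod_Icc_succ_top (by omega)]
      ring
  have hmain : ∀ k ≤ m, ∀ t ∈ Set.Ioc a (tp (k + 1)), u t ≤ C k * E t := by
    intro k
    induction k using Nat.strong_induction_on with
    | _ k ih =>
      intro hk
      have hsub : Set.Ioc a (tp (k + 1)) ⊆ Set.Icc a T := fun t ht =>
        ⟨ht.1.le, ht.2.trans (htpT ▸ hmono (k + 1) (m + 1) (by omega) le_rfl)⟩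
      refine fractional_gronwall hα (hC0 k hk) hlam (hu_int.mono_set hsub)
        (fun t ht => hu_nonneg t (hsub ht)) fun t ht => (hineq t (hsub ht)).trans ?_
      have himpulse : ∑ i ∈ (Finset.Icc 1 m).filter (fun i => tp i < t), β i * u (tp i) ≤
          ∑ i ∈ Finset.Icc 1 k, β i * (C (i - 1) * E (tp i)) := by
        refine (Finset.sum_le_sum (g := fun i => β i * (C (i - 1) * E (tp i)))
          fun i hi => ?_).trans (Finset.sum_le_sum_of_subset_of_nonneg ?_ ?_)
        all_goals
          have hlt : ∀ i ∈ (Finset.Icc 1 m).filter (fun i => tp i < t), 1 ≤ i ∧ i ≤ k := by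
            intro i hi
            obtain ⟨hi1, hit⟩ := Finset.mem_filter.1 hi
            obtain ⟨h1, h2⟩ := Finset.mem_Icc.1 hi1
            refine ⟨h1, not_lt.1 fun h => ?_⟩
            exact absurd (hmono (k + 1) i h (by omega)) (not_le.2 (hit.trans_le ht.2))
        · obtain ⟨h1, h2⟩ := hlt i hi
          refine mul_le_mul_of_nonneg_left ?_ (hβ i h1 (h2.trans hk)).le
          exact ih (i - 1) (by omega) (by omega) (tp i)
            ⟨ha_lt i h1 (by omega), by rw [Nat.sub_add_cancel h1]⟩
        · exact fun i hi => Finset.mem_Icc.2 (hlt i hi)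
        · intro i hi _
          obtain ⟨h1, h2⟩ := Finset.mem_Icc.1 hi
          exact mul_nonneg (hβ i h1 (h2.trans hk)).le
            (mul_nonneg (hC0 _ (by omega)) (hE0 _ (ha_lt i h1 (by omega)).le))
      have := hC_sum k
      linarith
  intro k hk t ht
  exact hmain k hk t ⟨(htp0 ▸ hmono 0 k (Nat.zero_le k) (by omega)).trans_lt ht.1, ht.2⟩
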